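/- Let 1 < p₁ < 2 < p₂ ≤ ∞. Then there exist constants c₂ ≥ c₁ > 0, depending only on p₁ and p₂, such that for every N ∈ ℕ and every k ∈ ℕ with 4k ≤ N one has c₁ · min(1, N^{1/p₁′} k^{−1/2}) ≤ c_k(id : ℓ_{p₁}^N → ℓ_{p₂}^N) ≤ c₂ · min(1, N^{1/p₁′} k^{−1/2}). -/

import Mathlib

open scoped ENNReal

instance : Fact ((1 : ℝ≥0∞) ≤ ∞) := ⟨le_top⟩

/-- The `k`-th Gelfand number of a continuous linear operator `T : X → Y`:
the infimum over closed subspaces `M ⊆ X` of codimension `< k` of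
`sup {‖T x‖ : x ∈ M, ‖x‖ ≤ 1}`. -/
noncomputable def gelfandNumber {X Y : Type*} [NormedAddCommGroup X] [NormedSpace ℂ X]
    [NormedAddCommGroup Y] [NormedSpace ℂ Y] (T : X →L[ℂ] Y) (k : ℕ) : ℝ :=
  sInf { r | ∃ M : Submodule ℂ X, IsClosed (M : Set X) ∧
    Module.rank ℂ (X ⧸ M) < (k : Cardinal) ∧
    r = ⨆ x : {x : M // ‖(x : X)‖ ≤ 1}, ‖T (x : X)‖ }

/-- The identity operator `id : ℓ_{p₁}^N → ℓ_{p₂}^N` on `ℂ^N`. -/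
noncomputable def lpId (p₁ p₂ : ℝ≥0∞) [Fact (1 ≤ p₁)] [Fact (1 ≤ p₂)] (N : ℕ) :
    PiLp p₁ (fun _ : Fin N => ℂ) →L[ℂ] PiLp p₂ (fun _ : Fin N => ℂ) :=
  LinearMap.toContinuousLinearMap
    (((WithLp.linearEquiv p₂ ℂ (Fin N → ℂ)).symm.toLinearMap).comp
      (WithLp.linearEquiv p₁ ℂ (Fin N → ℂ)).toLinearMap)

/-- The conjugate exponent `p′` of `p ∈ [1, ∞]`, characterized by `1/p + 1/p′ = 1`. -/
noncomputable def conjExp (p : ℝ≥0∞) : ℝ≥0∞ := (1 - p⁻¹)⁻¹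

open scoped BigOperators

section Expectation

theorem le_ciSup_of_finite {T : Type*} [Finite T] (f : T → ℝ) (t : T) : f t ≤ ⨆ s, f s :=
  le_ciSup (Set.finite_range f).bddAbove t

theorem expect_fin_succ {Ω : Type*} [Fintype Ω] (k : ℕ) (f : (Fin (k + 1) → Ω) → ℝ) :
    𝔼 G, f G = 𝔼 ω, 𝔼 G : Fin k → Ω, f (Fin.cons ω G) := by
  rw [← Finset.expect_product', Finset.univ_product_univ]
  refine (Fintype.expect_equiv (Fin.consEquiv fun _ => Ω) _ _ fun x => ?_).symm
  rfl

theorem expect_eq_expect_add_flip {Ω : Type*} [Fintype Ω] (e : Ω ≃ Ω) (f : Ω → ℝ) :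
    𝔼 ω, f ω = 𝔼 ω, (f ω + f (e ω)) / 2 := by
  have : 𝔼 ω, f (e ω) = 𝔼 ω, f ω := Fintype.expect_equiv e _ _ fun _ => rfl
  rw [← Finset.expect_div, Finset.expect_add_distrib, this]
  ring

variable {Ω T : Type*} [Fintype Ω] [Nonempty Ω] [Finite T] [Nonempty T]

/-- Contraction principle for the absolute value and a single symmetric sign. -/
theorem ciSup_add_abs_add_ciSup_sub_abs_le {T : Type*} [Finite T] [Nonempty T] (u b : T → ℝ) :
    (⨆ t, (u t + |b t|)) + (⨆ t, (u t - |b t|)) ≤ (⨆ t, (u t + b t)) + ⨆ t, (u t - b t) := by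
  refine ciSup_add_ciSup_le fun s t => ?_
  have h1 := le_ciSup_of_finite (fun t => u t + b t)
  have h2 := le_ciSup_of_finite (fun t => u t - b t)
  have h1s := h1 s
  have h1t := h1 t
  have h2s := h2 s
  have h2t := h2 t
  have h := (abs_sub_abs_le_abs_sub (b s) (b t))
  rcases abs_cases (b s - b t) with ⟨h', -⟩ | ⟨h', -⟩ <;> linarith

/-- Symmetrization and contraction for a single symmetric random functional. -/
theorem expect_ciSup_sub_abs_le [InvolutiveNeg Ω] (u : T → ℝ) (a : Ω → T → ℝ)
    (ha : ∀ ω t, a (-ω) t = -a ω t) :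
    𝔼 ω, ⨆ t, (u t + 𝔼 η, |a η t| - |a ω t|) ≤ 𝔼 ω, ⨆ t, (u t + 2 * a ω t) := by
  set P : Ω → ℝ := fun ω => ⨆ t, (u t + |2 * a ω t|) with hP
  set Q : Ω → ℝ := fun ω => ⨆ t, (u t - |2 * a ω t|) with hQ
  have h1 : ∀ ω, (⨆ t, (u t + 𝔼 η, |a η t| - |a ω t|)) ≤ 𝔼 η, (P η + Q ω) / 2 := by
    intro ω
    refine ciSup_le fun t => ?_
    have : u t + 𝔼 η, |a η t| - |a ω t| = 𝔼 η, (u t + |a η t| - |a ω t|) := by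
      rw [Finset.expect_sub_distrib, Finset.expect_add_distrib, Fintype.expect_const,
        Fintype.expect_const]
    rw [this]
    refine Finset.expect_le_expect fun η _ => ?_
    have h2 := le_ciSup_of_finite (fun t => u t + |2 * a η t|) t
    have h3 := le_ciSup_of_finite (fun t => u t - |2 * a ω t|) t
    simp only [abs_mul, abs_two] at h2 h3
    simp only [hP, hQ, abs_mul, abs_two]
    linarith
  have hneg : 𝔼 ω, (⨆ t, (u t - 2 * a ω t)) = 𝔼 ω, ⨆ t, (u t + 2 * a ω t) := by
    refine Fintype.expect_equiv (Equiv.neg Ω) _ _ fun ω => ?_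
    simp only [Equiv.neg_apply, ha]
    exact iSup_congr fun t => by ring
  calc 𝔼 ω, ⨆ t, (u t + 𝔼 η, |a η t| - |a ω t|)
      ≤ 𝔼 ω, 𝔼 η, (P η + Q ω) / 2 := Finset.expect_le_expect fun ω _ => h1 ω
    _ = 𝔼 ω, (P ω + Q ω) / 2 := by
      simp only [← Finset.expect_div, Finset.expect_add_distrib, Fintype.expect_const]
    _ ≤ 𝔼 ω, ((⨆ t, (u t + 2 * a ω t)) + ⨆ t, (u t - 2 * a ω t)) / 2 := by
      refine Finset.expect_le_expect fun ω _ => ?_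
      have := ciSup_add_abs_add_ciSup_sub_abs_le u (fun t => 2 * a ω t)
      simp only [hP, hQ]
      linarith
    _ = 𝔼 ω, ⨆ t, (u t + 2 * a ω t) := by
      rw [← Finset.expect_div, Finset.expect_add_distrib, hneg]
      ring

/-- Symmetrization and contraction for `k` independent copies of a symmetric random functional. -/
theorem expect_ciSup_sub_sum_abs_le [InvolutiveNeg Ω] (a : Ω → T → ℝ)
    (ha : ∀ ω t, a (-ω) t = -a ω t) (k : ℕ) (u : T → ℝ) :
    𝔼 G : Fin k → Ω, ⨆ t, (u t + k * 𝔼 η, |a η t| - ∑ i, |a (G i) t|) ≤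
      𝔼 G : Fin k → Ω, ⨆ t, (u t + 2 * ∑ i, a (G i) t) := by
  induction k generalizing u with
  | zero => simp
  | succ k ih =>
    rw [expect_fin_succ, expect_fin_succ]
    simp only [Fin.sum_univ_succ, Fin.cons_zero, Fin.cons_succ]
    calc _ = 𝔼 ω, 𝔼 G : Fin k → Ω, ⨆ t, ((u t + 𝔼 η, |a η t| - |a ω t|) +
            k * 𝔼 η, |a η t| - ∑ i, |a (G i) t|) := by
          refine Finset.expect_congr rfl fun ω _ => Finset.expect_congr rfl fun G _ =>
            iSup_congr fun t => ?_
          push_cast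
          ring
      _ ≤ 𝔼 ω, 𝔼 G : Fin k → Ω, ⨆ t, ((u t + 𝔼 η, |a η t| - |a ω t|) +
            2 * ∑ i, a (G i) t) := Finset.expect_le_expect fun ω _ => ih _
      _ = 𝔼 G : Fin k → Ω, 𝔼 ω, ⨆ t, ((u t + 2 * ∑ i, a (G i) t) + 𝔼 η, |a η t| - |a ω t|) := by
          rw [Finset.expect_comm]
          refine Finset.expect_congr rfl fun ω _ => Finset.expect_congr rfl fun G _ =>
            iSup_congr fun t => ?_
          ring
      _ ≤ 𝔼 G : Fin k → Ω, 𝔼 ω, ⨆ t, ((u t + 2 * ∑ i, a (G i) t) + 2 * a ω t) :=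
          Finset.expect_le_expect fun G _ => expect_ciSup_sub_abs_le _ a ha
      _ = _ := by
          rw [Finset.expect_comm]
          refine Finset.expect_congr rfl fun ω _ => Finset.expect_congr rfl fun G _ =>
            iSup_congr fun t => ?_
          ring

end Expectation

section Rademacher

/-- A finite family of independent symmetric signs: flipping any one of them is a symmetry of the
uniform probability space `Ω`. -/
structure IsRademacher {Ω κ : Type*} (ε : κ → Ω → ℝ) (φ : κ → Ω ≃ Ω) : Prop where
  sq_eq_one : ∀ j ω, ε j ω ^ 2 = 1
  flip_self : ∀ j ω, ε j (φ j ω) = -ε j ω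
  flip_of_ne : ∀ i j ω, i ≠ j → ε i (φ j ω) = ε i ω

theorem IsRademacher.sum_flip {Ω κ : Type*} {ε : κ → Ω → ℝ} {φ : κ → Ω ≃ Ω}
    (h : IsRademacher ε φ) (x : κ → ℝ) {s : Finset κ} {j : κ} (hj : j ∉ s) (ω : Ω) :
    ∑ i ∈ s, ε i (φ j ω) * x i = ∑ i ∈ s, ε i ω * x i :=
  Finset.sum_congr rfl fun i hi => by rw [h.flip_of_ne i j ω (ne_of_mem_of_not_mem hi hj)]

variable {Ω κ : Type*} [Fintype Ω] [Nonempty Ω] [DecidableEq κ]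
  {ε : κ → Ω → ℝ} {φ : κ → Ω ≃ Ω}

namespace IsRademacher

theorem expect_sum_sq (h : IsRademacher ε φ) (x : κ → ℝ) (s : Finset κ) :
    𝔼 ω, (∑ i ∈ s, ε i ω * x i) ^ 2 = ∑ i ∈ s, x i ^ 2 := by
  induction s using Finset.induction_on with
  | empty => simp
  | insert j s hj ih =>
    simp only [Finset.sum_insert hj]
    rw [expect_eq_expect_add_flip (φ j), ← ih]
    simp only [h.sum_flip x hj, h.flip_self]
    rw [← Fintype.expect_const (ι := Ω) (x j ^ 2), ← Finset.expect_add_distrib]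
    refine Finset.expect_congr rfl fun ω _ => ?_
    linear_combination x j ^ 2 * h.sq_eq_one j ω

theorem expect_sum_pow_four_le (h : IsRademacher ε φ) (x : κ → ℝ) (s : Finset κ) :
    𝔼 ω, (∑ i ∈ s, ε i ω * x i) ^ 4 ≤ 3 * (∑ i ∈ s, x i ^ 2) ^ 2 := by
  induction s using Finset.induction_on with
  | empty => simp
  | insert j s hj ih =>
    simp only [Finset.sum_insert hj]
    rw [expect_eq_expect_add_flip (φ j)]
    simp only [h.sum_flip x hj, h.flip_self]
    have : 𝔼 ω, ((ε j ω * x j + ∑ i ∈ s, ε i ω * x i) ^ 4 +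
        (-ε j ω * x j + ∑ i ∈ s, ε i ω * x i) ^ 4) / 2 =
        x j ^ 4 + 6 * x j ^ 2 * ∑ i ∈ s, x i ^ 2 + 𝔼 ω, (∑ i ∈ s, ε i ω * x i) ^ 4 := by
      rw [← h.expect_sum_sq x s, Finset.mul_expect, ← Fintype.expect_const (ι := Ω) (x j ^ 4),
        ← Finset.expect_add_distrib, ← Finset.expect_add_distrib]
      refine Finset.expect_congr rfl fun ω _ => ?_
      linear_combination (x j ^ 4 * (ε j ω ^ 2 + 1) +
        6 * x j ^ 2 * (∑ i ∈ s, ε i ω * x i) ^ 2) * h.sq_eq_one j ω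
    rw [this]
    nlinarith [sq_nonneg (x j ^ 2)]

/-- Khinchine's lower bound for the first absolute moment. -/
theorem le_expect_abs_sum [Fintype κ] (h : IsRademacher ε φ) (x : κ → ℝ) :
    5 / 9 * √(∑ i, x i ^ 2) ≤ 𝔼 ω, |∑ i, ε i ω * x i| := by
  set σ := √(∑ i, x i ^ 2) with hσ
  have hσ2 : σ ^ 2 = ∑ i, x i ^ 2 := Real.sq_sqrt (Finset.sum_nonneg fun i _ => sq_nonneg _)
  rcases (Real.sqrt_nonneg (∑ i, x i ^ 2)).eq_or_lt with h0 | h0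
  · rw [hσ, ← h0, mul_zero]
    exact Finset.expect_nonneg fun _ _ => abs_nonneg _
  change 0 < σ at h0
  have hpt : ∀ t : ℝ, t ^ 2 * σ ^ 2 - 4 / 27 * t ^ 4 ≤ σ ^ 3 * |t| := by
    intro t
    have h1 : 0 ≤ |t| := abs_nonneg t
    rw [← sq_abs t, show t ^ 4 = |t| ^ 4 by rw [← Even.pow_abs (by decide)]]
    have : 0 ≤ |t| * ((|t| + 3 * σ) * (2 * |t| - 3 * σ) ^ 2) := by positivity
    nlinarith
  have h2 : 𝔼 ω, ((∑ i, ε i ω * x i) ^ 2 * σ ^ 2 - 4 / 27 * (∑ i, ε i ω * x i) ^ 4) ≤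
      𝔼 ω, σ ^ 3 * |∑ i, ε i ω * x i| := Finset.expect_le_expect fun ω _ => hpt _
  rw [Finset.expect_sub_distrib, ← Finset.expect_mul, ← Finset.mul_expect, ← Finset.mul_expect,
    h.expect_sum_sq, ← hσ2] at h2
  have h4 := h.expect_sum_pow_four_le x Finset.univ
  rw [← hσ2] at h4
  have h3 : 0 < σ ^ 3 := by positivity
  refine le_of_mul_le_mul_left (le_trans ?_ h2) h3
  nlinarith

theorem expect_exp_sum_le (h : IsRademacher ε φ) (c : ℝ) (s : Finset κ) :
    𝔼 ω, Real.exp (c * ∑ i ∈ s, ε i ω) ≤ Real.exp (s.card * (c ^ 2 / 2)) := by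
  induction s using Finset.induction_on with
  | empty => simp
  | insert j s hj ih =>
    have hs : ∀ ω, ∑ i ∈ s, ε i (φ j ω) = ∑ i ∈ s, ε i ω := fun ω => by
      simpa using h.sum_flip (fun _ => 1) hj ω
    simp only [Finset.sum_insert hj]
    rw [expect_eq_expect_add_flip (φ j)]
    simp only [hs, h.flip_self]
    have hpt : ∀ ω, (Real.exp (c * (ε j ω + ∑ i ∈ s, ε i ω)) +
        Real.exp (c * (-ε j ω + ∑ i ∈ s, ε i ω))) / 2 =
        Real.cosh c * Real.exp (c * ∑ i ∈ s, ε i ω) := by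
      intro ω
      rw [mul_add, mul_add, Real.exp_add, Real.exp_add, ← add_mul, Real.cosh_eq]
      rcases mul_self_eq_one_iff.mp ((sq _).symm.trans (h.sq_eq_one j ω)) with h1 | h1 <;> rw [h1] <;>
        simp <;> ring
    simp only [hpt, ← Finset.mul_expect]
    rw [Finset.card_insert_of_notMem hj]
    push_cast
    rw [add_one_mul, add_comm, Real.exp_add]
    exact mul_le_mul (Real.cosh_le_exp_half_sq c) ih
      (Finset.expect_nonneg fun _ _ => (Real.exp_pos _).le) (Real.exp_pos _).le

/-- Khinchine's upper bound for moments of order `q`. -/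
theorem expect_abs_sum_rpow_le [Fintype κ] [Nonempty κ] (h : IsRademacher ε φ) {q : ℝ}
    (hq : 0 < q) :
    𝔼 ω, |(∑ i, ε i ω) / √(Fintype.card κ)| ^ q ≤ 4 * q ^ q := by
  have hk : (0 : ℝ) < Fintype.card κ := by exact_mod_cast Fintype.card_pos
  set c : ℝ := 1 / √(Fintype.card κ) with hc
  have hc2 : Fintype.card κ * (c ^ 2 / 2) = 1 / 2 := by
    rw [hc, div_pow, Real.sq_sqrt hk.le]
    field_simp
  have hpt : ∀ ω, |(∑ i, ε i ω) / √(Fintype.card κ)| ^ q ≤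
      q ^ q * (Real.exp (c * ∑ i, ε i ω) + Real.exp (-c * ∑ i, ε i ω)) := by
    intro ω
    have : (∑ i, ε i ω) / √(Fintype.card κ) = c * ∑ i, ε i ω := by rw [hc]; ring
    rw [this]
    set y := c * ∑ i, ε i ω with hy
    have h1 : |y| / q ≤ Real.exp (|y| / q) := by linarith [Real.add_one_le_exp (|y| / q)]
    have h2 : (|y| / q) ^ q ≤ Real.exp |y| := by
      calc (|y| / q) ^ q ≤ (Real.exp (|y| / q)) ^ q :=
            Real.rpow_le_rpow (by positivity) h1 hq.le
        _ = Real.exp |y| := by rw [← Real.exp_mul, div_mul_cancel₀ _ hq.ne']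
    rw [Real.div_rpow (abs_nonneg _) hq.le, div_le_iff₀ (by positivity)] at h2
    have h3 : Real.exp |y| ≤ Real.exp y + Real.exp (-y) := by
      rcases abs_cases y with ⟨h', -⟩ | ⟨h', -⟩ <;> rw [h'] <;>
        linarith [Real.exp_pos y, Real.exp_pos (-y)]
    rw [neg_mul, ← hy, mul_comm]
    exact h2.trans (mul_le_mul_of_nonneg_right h3 (by positivity))
  refine (Finset.expect_le_expect fun ω _ => hpt ω).trans ?_
  rw [← Finset.mul_expect, Finset.expect_add_distrib, mul_comm]
  have e1 := h.expect_exp_sum_le c Finset.univ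
  have e2 := h.expect_exp_sum_le (-c) Finset.univ
  rw [neg_sq] at e2
  rw [Finset.card_univ, hc2] at e1 e2
  have e3 : Real.exp (1 / 2) ≤ 2 := by
    have h1 : Real.exp (1 / 2) ^ 2 = Real.exp 1 := by
      rw [← Real.exp_nat_mul]; norm_num
    nlinarith [Real.exp_one_lt_d9, Real.exp_pos (1 / 2)]
  exact mul_le_mul_of_nonneg_right (by linarith) (by positivity)

end IsRademacher

end Rademacher

section KernelOfSigns

variable {N : ℕ}

/-- The involution of `Fin N → ℤˣ` changing the sign of the `j`-th coordinate. -/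
def flipSign (j : Fin N) : (Fin N → ℤˣ) ≃ (Fin N → ℤˣ) :=
  Function.Involutive.toPerm (fun ω => Function.update ω j (-ω j)) fun ω => by simp

theorem flipSign_apply (j : Fin N) (ω : Fin N → ℤˣ) :
    flipSign j ω = Function.update ω j (-ω j) := rfl

theorem units_cast_sq (u : ℤˣ) : ((u : ℤ) : ℝ) ^ 2 = 1 := by
  rcases Int.units_eq_one_or u with h | h <;> simp [h]

theorem isRademacher_coord :
    IsRademacher (fun (j : Fin N) (ω : Fin N → ℤˣ) => ((ω j : ℤ) : ℝ)) flipSign where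
  sq_eq_one _ _ := units_cast_sq _
  flip_self j ω := by simp [flipSign_apply]
  flip_of_ne i j ω hij := by simp [flipSign_apply, hij]

/-- The involution of the `k × N` sign matrices changing the sign of the `(i, j)` entry. -/
def flipEntry {k : ℕ} (j : Fin N) (i : Fin k) :
    (Fin k → Fin N → ℤˣ) ≃ (Fin k → Fin N → ℤˣ) :=
  Function.Involutive.toPerm (fun G => Function.update G i (flipSign j (G i))) fun G => by
    simp [flipSign_apply]

theorem flipEntry_apply {k : ℕ} (j : Fin N) (i : Fin k) (G : Fin k → Fin N → ℤˣ) :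
    flipEntry j i G = Function.update G i (flipSign j (G i)) := rfl

theorem isRademacher_column {k : ℕ} (j : Fin N) :
    IsRademacher (fun (i : Fin k) (G : Fin k → Fin N → ℤˣ) => ((G i j : ℤ) : ℝ))
      (flipEntry j) where
  sq_eq_one _ _ := units_cast_sq _
  flip_self i G := by simp [flipEntry_apply, flipSign_apply]
  flip_of_ne i i' G hi := by simp [flipEntry_apply, hi]

/-- The constant in the bound for the Euclidean radius of kernels of sign matrices. -/
noncomputable def kernelConst (q : ℝ) : ℝ := 18 / 5 * (4 * q ^ q + 1)

/-- There is a `k × N` sign matrix on whose kernel the Euclidean norm is bounded by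
`N ^ (1 / q) / √k` times the `ℓ_p` norm. -/
theorem exists_signs_kernel {p q : ℝ} (hpq : p.HolderConjugate q) {k : ℕ} (hk : 0 < k)
    (hN : 0 < N) :
    ∃ G : Fin k → Fin N → ℤˣ, ∀ x : Fin N → ℝ, (∀ i, ∑ j, ((G i j : ℤ) : ℝ) * x j = 0) →
      ∑ j, |x j| ^ p ≤ 1 →
        √(∑ j, x j ^ 2) ≤ kernelConst q * ((N : ℝ) ^ (1 / q) / √k) := by
  by_contra! hcon
  choose x hker hp hlarge using hcon
  have hNr : (0 : ℝ) < N := by exact_mod_cast hN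
  have hkr : (0 : ℝ) < k := by exact_mod_cast hk
  have : Nonempty (Fin k) := ⟨⟨0, hk⟩⟩
  have hq := hpq.symm.pos
  set ρ := kernelConst q * ((N : ℝ) ^ (1 / q) / √k) with hρ
  set B : ℝ := (N : ℝ) ^ (1 / q) * √k with hB
  have hBpos : 0 < B := by positivity
  let a : (Fin N → ℤˣ) → (Fin k → Fin N → ℤˣ) → ℝ := fun ω t => ∑ j, ((ω j : ℤ) : ℝ) * x t j
  have key := expect_ciSup_sub_sum_abs_le a (fun ω t => by simp [a]) k 0
  simp only [Pi.zero_apply, zero_add] at key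
  have hlow : k * (5 / 9 * ρ) < 𝔼 G : Fin k → Fin N → ℤˣ,
      ⨆ t, (k * 𝔼 η, |a η t| - ∑ i, |a (G i) t|) := by
    have hpt : ∀ G : Fin k → Fin N → ℤˣ,
        k * (5 / 9 * ρ) < ⨆ t, (k * 𝔼 η, |a η t| - ∑ i, |a (G i) t|) := by
      intro G
      have h1 : ∑ i, |a (G i) G| = 0 := Finset.sum_eq_zero fun i _ => by simp [a, hker]
      have h2 : 5 / 9 * √(∑ j, x G j ^ 2) ≤ 𝔼 η, |a η G| :=
        isRademacher_coord.le_expect_abs_sum (x G)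
      have h3 := hlarge G
      refine lt_of_lt_of_le ?_
        (le_ciSup_of_finite (fun t => k * 𝔼 η, |a η t| - ∑ i, |a (G i) t|) G)
      rw [h1, sub_zero]
      exact mul_lt_mul_of_pos_left (by linarith) hkr
    exact Finset.lt_expect (fun G _ => (hpt G).le) ⟨1, Finset.mem_univ _, hpt 1⟩
  have hup : 𝔼 G : Fin k → Fin N → ℤˣ, ⨆ t, 2 * ∑ i, a (G i) t ≤ 2 * (B * (4 * q ^ q + 1)) := by
    have hpt : ∀ G : Fin k → Fin N → ℤˣ, (⨆ t, 2 * ∑ i, a (G i) t) ≤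
        2 * (B * (1 / N * ∑ j, |(∑ i, ((G i j : ℤ) : ℝ)) / √(Fintype.card (Fin k))| ^ q + 1)) := by
      intro G
      refine ciSup_le fun t => ?_
      have h1 : ∑ i, a (G i) t =
          B * ∑ j, (∑ i, ((G i j : ℤ) : ℝ)) / √k / (N : ℝ) ^ (1 / q) * x t j := by
        simp only [a]
        rw [Finset.sum_comm, Finset.mul_sum]
        refine Finset.sum_congr rfl fun j _ => ?_
        rw [← Finset.sum_mul, hB]
        have := Real.sqrt_pos.mpr hkr
        field_simp
      have h2 : ∀ j, (∑ i, ((G i j : ℤ) : ℝ)) / √k / (N : ℝ) ^ (1 / q) * x t j ≤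
          1 / N * |(∑ i, ((G i j : ℤ) : ℝ)) / √k| ^ q + |x t j| ^ p := by
        intro j
        refine (Real.young_inequality _ _ hpq.symm).trans (add_le_add ?_ ?_)
        · refine (div_le_self (by positivity) hpq.symm.lt.le).trans_eq ?_
          rw [abs_div _ ((N : ℝ) ^ (1 / q)), Real.div_rpow (abs_nonneg _) (abs_nonneg _),
            abs_of_pos (by positivity : (0 : ℝ) < (N : ℝ) ^ (1 / q)), ← Real.rpow_mul hNr.le,
            one_div_mul_cancel hq.ne', Real.rpow_one]
          ring
        · exact div_le_self (by positivity) hpq.lt.le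
      have h3 := (Finset.sum_le_sum fun j (_ : j ∈ Finset.univ) => h2 j)
      rw [Finset.sum_add_distrib, ← Finset.mul_sum] at h3
      rw [h1, Fintype.card_fin]
      have h4 := hp t
      gcongr
      linarith
    refine (Finset.expect_le_expect fun G _ => hpt G).trans ?_
    rw [← Finset.mul_expect, ← Finset.mul_expect, Finset.expect_add_distrib,
      ← Finset.mul_expect, Finset.expect_sum_comm, Fintype.expect_const]
    have h5 : ∑ j : Fin N, 𝔼 G : Fin k → Fin N → ℤˣ,
        |(∑ i, ((G i j : ℤ) : ℝ)) / √(Fintype.card (Fin k))| ^ q ≤ N * (4 * q ^ q) := by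
      refine (Finset.sum_le_sum fun j _ =>
        (isRademacher_column (k := k) j).expect_abs_sum_rpow_le hq).trans ?_
      simp
    rw [← inv_mul_le_iff₀ hNr, ← one_div] at h5
    exact mul_le_mul_of_nonneg_left
      (mul_le_mul_of_nonneg_left (by linarith) hBpos.le) two_pos.le
  have hfin : k * (5 / 9 * ρ) = 2 * (B * (4 * q ^ q + 1)) := by
    have hs := Real.sqrt_pos.mpr hkr
    rw [hρ, hB, kernelConst]
    nth_rewrite 1 [← Real.sq_sqrt hkr.le]
    field_simp
    ring
  linarith

end KernelOfSigns

section Gelfand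

variable {X Y : Type*} [NormedAddCommGroup X] [NormedSpace ℂ X]
  [NormedAddCommGroup Y] [NormedSpace ℂ Y]

theorem gelfandNumber_le (T : X →L[ℂ] Y) {k : ℕ} {c : ℝ} (hc : 0 ≤ c) (M : Submodule ℂ X)
    (hM : IsClosed (M : Set X)) (hr : Module.rank ℂ (X ⧸ M) < (k : Cardinal))
    (h : ∀ x ∈ M, ‖T x‖ ≤ c * ‖x‖) : gelfandNumber T k ≤ c := by
  refine csInf_le_of_le ⟨0, ?_⟩ ⟨M, hM, hr, rfl⟩ ?_
  · rintro _ ⟨M, -, -, rfl⟩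
    exact Real.iSup_nonneg fun _ => norm_nonneg _
  · exact Real.iSup_le (fun x => (h x.1 x.1.2).trans (mul_le_of_le_one_right hc x.2)) hc

theorem le_gelfandNumber (T : X →L[ℂ] Y) {k : ℕ} (hk : 1 ≤ k) {c : ℝ}
    (h : ∀ M : Submodule ℂ X, Module.rank ℂ (X ⧸ M) < (k : Cardinal) →
      ∃ x ∈ M, x ≠ 0 ∧ c * ‖x‖ ≤ ‖T x‖) : c ≤ gelfandNumber T k := by
  refine le_csInf ⟨_, ⊤, isClosed_univ, ?_, rfl⟩ ?_
  · rw [rank_subsingleton']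
    exact_mod_cast hk
  · rintro _ ⟨M, -, hr, rfl⟩
    obtain ⟨x, hx, hx0, hle⟩ := h M hr
    have hpos : 0 < ‖x‖ := norm_pos_iff.mpr hx0
    have hbdd : BddAbove (Set.range fun x : {x : M // ‖(x : X)‖ ≤ 1} => ‖T (x : X)‖) := by
      refine ⟨‖T‖, ?_⟩
      rintro _ ⟨y, rfl⟩
      exact T.unit_le_opNorm _ y.2
    have hn : ‖((‖x‖⁻¹ : ℝ) : ℂ) • x‖ = 1 := by
      rw [norm_smul, Complex.norm_real, norm_inv, norm_norm, inv_mul_cancel₀ hpos.ne']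
    refine le_ciSup_of_le hbdd ⟨⟨((‖x‖⁻¹ : ℝ) : ℂ) • x, M.smul_mem _ hx⟩, hn.le⟩ ?_
    rw [map_smul, norm_smul, Complex.norm_real, norm_inv, norm_norm, inv_mul_eq_div,
      le_div_iff₀ hpos]
    exact hle

end Gelfand

section PiLpNorms

variable {N : ℕ}

theorem lpId_apply (p₁ p₂ : ℝ≥0∞) [Fact (1 ≤ p₁)] [Fact (1 ≤ p₂)]
    (x : PiLp p₁ (fun _ : Fin N => ℂ)) : lpId p₁ p₂ N x = WithLp.toLp p₂ x.ofLp := rfl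

theorem norm_toLp_le_of_exponent_le {s t : ℝ≥0∞} [Fact (1 ≤ s)] [Fact (1 ≤ t)] (hs : s ≠ ∞)
    (hst : s ≤ t) (x : Fin N → ℂ) : ‖WithLp.toLp t x‖ ≤ ‖WithLp.toLp s x‖ := by
  have hle : ∀ i, ‖x i‖ ≤ ‖WithLp.toLp s x‖ := PiLp.norm_apply_le (WithLp.toLp s x)
  have hs0 : 0 < s.toReal := ENNReal.toReal_pos (zero_lt_one.trans_le Fact.out).ne' hs
  rcases eq_or_ne t ∞ with rfl | ht
  · rw [PiLp.norm_eq_ciSup]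
    exact Real.iSup_le hle (norm_nonneg _)
  have ht0 : 0 < t.toReal := ENNReal.toReal_pos (zero_lt_one.trans_le Fact.out).ne' ht
  have hst' : s.toReal ≤ t.toReal := ENNReal.toReal_mono ht hst
  set A := ‖WithLp.toLp s x‖ with hA
  have hA0 : 0 ≤ A := norm_nonneg _
  have hsum : ∑ i, ‖x i‖ ^ s.toReal = A ^ s.toReal := by
    rw [hA, PiLp.norm_eq_sum hs0, ← Real.rpow_mul (by positivity), one_div_mul_cancel hs0.ne',
      Real.rpow_one]
  rw [PiLp.norm_eq_sum ht0, one_div, Real.rpow_inv_le_iff_of_pos (by positivity) hA0 ht0]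
  calc ∑ i, ‖x i‖ ^ t.toReal ≤ ∑ i, ‖x i‖ ^ s.toReal * A ^ (t.toReal - s.toReal) := by
        refine Finset.sum_le_sum fun i _ => ?_
        rw [← add_sub_cancel s.toReal t.toReal,
          Real.rpow_add_of_nonneg (norm_nonneg _) hs0.le (sub_nonneg.mpr hst'), add_sub_cancel]
        exact mul_le_mul_of_nonneg_left
          (Real.rpow_le_rpow (norm_nonneg _) (hle i) (sub_nonneg.mpr hst')) (by positivity)
    _ = A ^ t.toReal := by
        rw [← Finset.sum_mul, hsum, ← Real.rpow_add_of_nonneg hA0 hs0.le (sub_nonneg.mpr hst'),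
          add_sub_cancel]

theorem norm_toLp_le_mul_norm_toLp_two {p : ℝ≥0∞} [Fact (1 ≤ p)] (hp : p ≤ 2)
    (x : Fin N → ℂ) :
    ‖WithLp.toLp p x‖ ≤ (N : ℝ) ^ (1 / p.toReal - 1 / 2) * ‖WithLp.toLp 2 x‖ := by
  have hp' : p ≠ ∞ := ne_top_of_le_ne_top ENNReal.ofNat_ne_top hp
  have hp0 : 0 < p.toReal := ENNReal.toReal_pos (zero_lt_one.trans_le Fact.out).ne' hp'
  have hp2 : p.toReal ≤ 2 := by simpa using ENNReal.toReal_mono ENNReal.ofNat_ne_top hp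
  have h := Real.rpow_sum_le_const_mul_sum_rpow Finset.univ (fun i => ‖x i‖ ^ p.toReal)
    ((one_le_div hp0).mpr hp2)
  have h1 : ∀ i, |‖x i‖ ^ p.toReal| = ‖x i‖ ^ p.toReal := fun i => abs_of_nonneg (by positivity)
  have h2 : ∀ i, (‖x i‖ ^ p.toReal) ^ (2 / p.toReal) = ‖x i‖ ^ (2 : ℝ) := fun i => by
    rw [← Real.rpow_mul (norm_nonneg _), mul_div_cancel₀ _ hp0.ne']
  simp only [h1, h2, Finset.card_univ, Fintype.card_fin] at h
  have h3 := Real.rpow_le_rpow (by positivity) h (by norm_num : (0 : ℝ) ≤ 1 / 2)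
  rw [Real.mul_rpow (by positivity) (by positivity), ← Real.rpow_mul (by positivity),
    ← Real.rpow_mul (by positivity)] at h3
  rw [PiLp.norm_eq_sum hp0, PiLp.norm_eq_sum (by simp)]
  convert h3 using 2
  · field_simp
  · congr 1
    field_simp
  · simp

end PiLpNorms

section LowerBound

variable {N : ℕ}

theorem sum_norm_sq_orthogonalProjectionOnto_single (K : Submodule ℂ (EuclideanSpace ℂ (Fin N))) :
    ∑ i, ‖K.orthogonalProjectionOnto (EuclideanSpace.single i 1)‖ ^ 2 = Module.finrank ℂ K := by
  have b := stdOrthonormalBasis ℂ K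
  simp_rw [← b.sum_sq_norm_inner_right]
  rw [Finset.sum_comm]
  have h1 : ∀ j, ∑ i, ‖inner ℂ (b j) (K.orthogonalProjectionOnto (EuclideanSpace.single i 1))‖ ^ 2
      = 1 := by
    intro j
    have h2 : ∀ i, ‖inner ℂ (b j) (K.orthogonalProjectionOnto (EuclideanSpace.single i 1))‖ =
        ‖(b j : EuclideanSpace ℂ (Fin N)) i‖ := by
      intro i
      rw [Submodule.inner_orthogonalProjectionOnto_eq_of_mem_left, EuclideanSpace.inner_single_right]
      simp
    simp_rw [h2]
    rw [← EuclideanSpace.norm_sq_eq, Submodule.norm_coe, b.norm_eq_one, one_pow]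
  rw [Finset.sum_congr rfl fun j _ => h1 j]
  simp

theorem exists_mem_orthogonal_peak (K : Submodule ℂ (EuclideanSpace ℂ (Fin N))) {k : ℕ}
    (hK : Module.finrank ℂ K ≤ k) (hk : 1 ≤ k) (hN : 4 * k ≤ N) :
    ∃ i, ∃ z : EuclideanSpace ℂ (Fin N), EuclideanSpace.single i 1 - z ∈ Kᗮ ∧
      ‖z‖ ^ 2 ≤ k / N ∧ ‖z i‖ ≤ 1 / 4 := by
  have hNr : (0 : ℝ) < N := by exact_mod_cast (by lia : 0 < N)
  have : Nonempty (Fin N) := ⟨⟨0, by lia⟩⟩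
  have hkN : (k : ℝ) / N ≤ 1 / 4 := by
    rw [div_le_iff₀ hNr]
    have : (4 * k : ℝ) ≤ N := by exact_mod_cast hN
    linarith
  have hsum : ∑ i, ‖K.orthogonalProjectionOnto (EuclideanSpace.single i 1)‖ ^ 2 ≤
      ∑ _i : Fin N, (k : ℝ) / N := by
    rw [sum_norm_sq_orthogonalProjectionOnto_single]
    simp only [Finset.sum_const, Finset.card_univ, Fintype.card_fin, nsmul_eq_mul]
    rw [mul_div_cancel₀ _ hNr.ne']
    exact_mod_cast hK
  obtain ⟨i, -, hi⟩ := Finset.exists_le_of_sum_le Finset.univ_nonempty hsum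
  refine ⟨i, K.orthogonalProjectionOnto (EuclideanSpace.single i 1),
    K.sub_starProjection_mem_orthogonal _, hi, ?_⟩
  set z := K.orthogonalProjectionOnto (EuclideanSpace.single i (1 : ℂ)) with hz
  have h1 := Submodule.inner_orthogonalProjectionOnto_eq_of_mem_left z (EuclideanSpace.single i 1)
  rw [← hz, inner_self_eq_norm_sq_to_K, EuclideanSpace.inner_single_right] at h1
  have h2 := (congrArg norm h1).symm
  rw [one_mul, norm_pow, RCLike.norm_conj] at h2
  rw [h2]
  simpa using hi.trans hkN

theorem min_le_gelfandNumber_lpId (p₁ p₂ : ℝ≥0∞) [Fact (1 ≤ p₁)] [Fact (1 ≤ p₂)] (h₁ : p₁ ≤ 2) {k : ℕ}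
    (hk : 1 ≤ k) (hN : 4 * k ≤ N) :
    3 / 8 * min 1 ((N : ℝ) ^ (1 - 1 / p₁.toReal) * (k : ℝ) ^ (-(1 / 2) : ℝ)) ≤
      gelfandNumber (lpId p₁ p₂ N) k := by
  refine le_gelfandNumber _ hk fun M hM => ?_
  have hNr : (0 : ℝ) < N := by exact_mod_cast (by lia : 0 < N)
  have hkr : (0 : ℝ) < k := by exact_mod_cast hk
  let e : PiLp p₁ (fun _ : Fin N => ℂ) ≃ₗ[ℂ] EuclideanSpace ℂ (Fin N) :=
    (WithLp.linearEquiv p₁ ℂ (Fin N → ℂ)).trans (WithLp.linearEquiv 2 ℂ (Fin N → ℂ)).symm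
  set M' := M.map e.toLinearMap with hM'
  have hfin : Module.finrank ℂ M'ᗮ ≤ k := by
    have h1 := M'.finrank_add_finrank_orthogonal
    have h2 := M.finrank_quotient_add_finrank
    have h3 : Module.finrank ℂ M' = Module.finrank ℂ M := LinearEquiv.finrank_map_eq e M
    have h4 := e.finrank_eq
    have h5 : Module.finrank ℂ (_ ⧸ M) < k := by
      rw [← Module.finrank_eq_rank] at hM
      exact_mod_cast hM
    have h6 : Module.finrank ℂ M' + Module.finrank ℂ M'ᗮ ≤ Module.finrank ℂ M' + k := by
      rw [h1, h3, add_comm]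
      exact (h4.symm.trans h2.symm).le.trans (Nat.add_le_add_right h5.le _)
    exact le_of_add_le_add_left h6
  obtain ⟨i, z, hz, hz2, hzi⟩ := exists_mem_orthogonal_peak M'ᗮ hfin hk hN
  rw [Submodule.orthogonal_orthogonal] at hz
  obtain ⟨x, hxM, hx⟩ := hz
  have hxz : x = WithLp.toLp p₁ (Pi.single i 1) - WithLp.toLp p₁ z.ofLp := by
    apply e.injective
    exact hx
  have hxi : 3 / 4 ≤ ‖x i‖ := by
    have h1 : x i = 1 - z i := by simp [hxz]
    rw [h1]
    have := norm_sub_norm_le (1 : ℂ) (z i)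
    rw [norm_one] at this
    linarith
  set μ : ℝ := (N : ℝ) ^ (1 - 1 / p₁.toReal) * (k : ℝ) ^ (-(1 / 2) : ℝ) with hμ
  have hμ0 : 0 < μ := by positivity
  have hzp : ‖WithLp.toLp p₁ z.ofLp‖ ≤ μ⁻¹ := by
    refine (norm_toLp_le_mul_norm_toLp_two h₁ z.ofLp).trans ?_
    have h1 : ‖z‖ ≤ (k : ℝ) ^ (1 / 2 : ℝ) * (N : ℝ) ^ (-(1 / 2) : ℝ) := by
      rw [Real.rpow_neg hNr.le, ← div_eq_mul_inv, ← Real.div_rpow hkr.le hNr.le,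
        ← Real.sqrt_eq_rpow]
      exact Real.le_sqrt_of_sq_le hz2
    refine (mul_le_mul_of_nonneg_left h1 (by positivity)).trans_eq ?_
    rw [hμ, mul_inv, ← Real.rpow_neg hNr.le, ← Real.rpow_neg hkr.le, neg_neg, mul_left_comm,
      ← Real.rpow_add hNr, mul_comm]
    congr 2
    ring
  have hxp : ‖x‖ ≤ 1 + μ⁻¹ := by
    rw [hxz]
    refine (norm_sub_le _ _).trans (add_le_add (le_of_eq ?_) hzp)
    have := PiLp.norm_single p₁ (fun _ : Fin N => ℂ) i 1
    rw [norm_one] at this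
    exact this
  refine ⟨x, hxM, ?_, ?_⟩
  · rintro rfl
    norm_num at hxi
  · have h1 : ‖x i‖ ≤ ‖lpId p₁ p₂ N x‖ := PiLp.norm_apply_le (lpId p₁ p₂ N x) i
    refine le_trans ?_ (hxi.trans h1)
    have h2 : min 1 μ * (1 + μ⁻¹) ≤ 2 := by
      have ha : min 1 μ * 1 ≤ 1 := by simp
      have hb : min 1 μ * μ⁻¹ ≤ μ * μ⁻¹ :=
        mul_le_mul_of_nonneg_right (min_le_right _ _) (by positivity)
      rw [mul_inv_cancel₀ hμ0.ne'] at hb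
      linarith
    have h3 : min 1 μ * ‖x‖ ≤ min 1 μ * (1 + μ⁻¹) :=
      mul_le_mul_of_nonneg_left hxp (by positivity)
    linarith

end LowerBound

section UpperBound

variable {N : ℕ}

theorem sqrt_sum_sq_le_of_forall_sum_rpow_le_one {p c : ℝ}
    {V : Submodule ℝ (Fin N → ℝ)}
    (hV : ∀ x ∈ V, ∑ j, |x j| ^ p ≤ 1 → √(∑ j, x j ^ 2) ≤ c) {x : Fin N → ℝ} (hx : x ∈ V) {A : ℝ}
    (hA : 0 < A) (hxA : ∑ j, |x j| ^ p ≤ A ^ p) : √(∑ j, x j ^ 2) ≤ c * A := by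
  have h := hV (A⁻¹ • x) (V.smul_mem _ hx) ?_
  · simp only [Pi.smul_apply, smul_eq_mul, mul_pow, ← Finset.mul_sum] at h
    rw [Real.sqrt_mul (sq_nonneg _), Real.sqrt_sq (by positivity), inv_mul_le_iff₀ hA] at h
    linarith
  · simp only [Pi.smul_apply, smul_eq_mul, abs_mul, abs_inv, abs_of_pos hA]
    simp only [Real.mul_rpow (inv_nonneg.mpr hA.le) (abs_nonneg _), ← Finset.mul_sum]
    rw [Real.inv_rpow hA.le, inv_mul_le_iff₀ (by positivity), mul_one]
    exact hxA

theorem norm_toLp_two_le_of_re_im {p c : ℝ} (hp : 0 < p) {V : Submodule ℝ (Fin N → ℝ)}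
    (hV : ∀ x ∈ V, ∑ j, |x j| ^ p ≤ 1 → √(∑ j, x j ^ 2) ≤ c) {x : Fin N → ℂ}
    (hre : (fun j => (x j).re) ∈ V) (him : (fun j => (x j).im) ∈ V) {A : ℝ} (hA : 0 < A)
    (hxA : ∑ j, ‖x j‖ ^ p ≤ A ^ p) : ‖WithLp.toLp 2 x‖ ≤ 2 * (c * A) := by
  have h1 := sqrt_sum_sq_le_of_forall_sum_rpow_le_one hV hre hA
    ((Finset.sum_le_sum fun j _ =>
      Real.rpow_le_rpow (abs_nonneg _) (Complex.abs_re_le_norm _) hp.le).trans hxA)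
  have h2 := sqrt_sum_sq_le_of_forall_sum_rpow_le_one hV him hA
    ((Finset.sum_le_sum fun j _ =>
      Real.rpow_le_rpow (abs_nonneg _) (Complex.abs_im_le_norm _) hp.le).trans hxA)
  have h3 : ‖WithLp.toLp 2 x‖ = √(∑ j, (x j).re ^ 2 + ∑ j, (x j).im ^ 2) := by
    rw [EuclideanSpace.norm_eq, ← Finset.sum_add_distrib]
    congr 1
    refine Finset.sum_congr rfl fun j _ => ?_
    rw [Complex.sq_norm, Complex.normSq_apply]
    ring
  rw [h3]
  have h4 : 0 ≤ ∑ j, (x j).re ^ 2 := Finset.sum_nonneg fun _ _ => sq_nonneg _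
  have h5 : 0 ≤ ∑ j, (x j).im ^ 2 := Finset.sum_nonneg fun _ _ => sq_nonneg _
  have h6 : √(∑ j, (x j).re ^ 2 + ∑ j, (x j).im ^ 2) ≤
      √(∑ j, (x j).re ^ 2) + √(∑ j, (x j).im ^ 2) := by
    refine Real.sqrt_le_iff.mpr ⟨by positivity, ?_⟩
    rw [add_sq, Real.sq_sqrt h4, Real.sq_sqrt h5]
    have : 0 ≤ √(∑ j, (x j).re ^ 2) * √(∑ j, (x j).im ^ 2) := by positivity
    linarith
  linarith

/-- The complex linear map given by the real sign matrix `G`. -/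
noncomputable def signMap (p : ℝ≥0∞) {m : ℕ} (G : Fin m → Fin N → ℤˣ) :
    PiLp p (fun _ : Fin N => ℂ) →ₗ[ℂ] (Fin m → ℂ) :=
  (Matrix.mulVecLin (Matrix.of fun i j => ((G i j : ℤ) : ℂ))) ∘ₗ
    (WithLp.linearEquiv p ℂ (Fin N → ℂ)).toLinearMap

theorem signMap_apply (p : ℝ≥0∞) {m : ℕ} (G : Fin m → Fin N → ℤˣ)
    (x : PiLp p (fun _ : Fin N => ℂ)) (i : Fin m) :
    signMap p G x i = ∑ j, ((G i j : ℤ) : ℂ) * x j := rfl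

theorem rank_quotient_ker_signMap_lt (p : ℝ≥0∞) {m : ℕ} (G : Fin m → Fin N → ℤˣ) :
    Module.rank ℂ (PiLp p (fun _ : Fin N => ℂ) ⧸ LinearMap.ker (signMap p G)) <
      ((m + 1 : ℕ) : Cardinal) := by
  rw [(signMap p G).quotKerEquivRange.rank_eq]
  refine (Submodule.rank_le _).trans_lt ?_
  rw [rank_fin_fun]
  exact_mod_cast m.lt_succ_self

theorem gelfandNumber_le_one (p₁ p₂ : ℝ≥0∞) [Fact (1 ≤ p₁)] [Fact (1 ≤ p₂)] (h₁ : p₁ ≠ ∞)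
    (h : p₁ ≤ p₂) {k : ℕ} (hk : 1 ≤ k) : gelfandNumber (lpId p₁ p₂ N) k ≤ 1 := by
  refine gelfandNumber_le _ zero_le_one ⊤ isClosed_univ ?_ fun x _ => ?_
  · rw [rank_subsingleton']
    exact_mod_cast hk
  · rw [one_mul]
    exact norm_toLp_le_of_exponent_le h₁ h x.ofLp

theorem gelfandNumber_succ_le (p₁ p₂ : ℝ≥0∞) [Fact (1 ≤ p₁)] [Fact (1 ≤ p₂)]
    (h₂ : 2 ≤ p₂) {q : ℝ} (hq : p₁.toReal.HolderConjugate q) {m : ℕ} (hm : 0 < m) (hN : 0 < N) :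
    gelfandNumber (lpId p₁ p₂ N) (m + 1) ≤
      2 * (kernelConst q * ((N : ℝ) ^ (1 / q) / √m)) := by
  obtain ⟨G, hG⟩ := exists_signs_kernel hq hm hN
  set c := kernelConst q * ((N : ℝ) ^ (1 / q) / √m)
  let V : Submodule ℝ (Fin N → ℝ) :=
    LinearMap.ker (Matrix.mulVecLin (Matrix.of fun i j => ((G i j : ℤ) : ℝ)))
  have hV_mem : ∀ x, x ∈ V ↔ ∀ i, ∑ j, ((G i j : ℤ) : ℝ) * x j = 0 := fun x => funext_iff
  have hV : ∀ x ∈ V, ∑ j, |x j| ^ p₁.toReal ≤ 1 → √(∑ j, x j ^ 2) ≤ c :=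
    fun x hx => hG x ((hV_mem x).mp hx)
  have hc : 0 ≤ c := (Real.sqrt_nonneg _).trans
    (hV 0 V.zero_mem (by simp [Real.zero_rpow hq.pos.ne']))
  refine gelfandNumber_le _ (by positivity) (LinearMap.ker (signMap p₁ G))
    (Submodule.closed_of_finiteDimensional _) (rank_quotient_ker_signMap_lt p₁ G) fun x hx => ?_
  rcases eq_or_ne x 0 with rfl | hx0
  · simp
  have hker : ∀ i, ∑ j, ((G i j : ℤ) : ℂ) * x j = 0 := fun i => congrFun hx i
  refine (norm_toLp_le_of_exponent_le ENNReal.ofNat_ne_top h₂ x.ofLp).trans ?_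
  rw [mul_assoc]
  refine norm_toLp_two_le_of_re_im hq.pos hV ?_ ?_ (norm_pos_iff.mpr hx0) ?_
  · refine (hV_mem _).mpr fun i => ?_
    simpa using congrArg Complex.re (hker i)
  · refine (hV_mem _).mpr fun i => ?_
    simpa using congrArg Complex.im (hker i)
  · rw [PiLp.norm_eq_sum hq.pos, ← Real.rpow_mul (by positivity), one_div_mul_cancel hq.ne_zero,
      Real.rpow_one]

theorem one_le_kernelConst {q : ℝ} (hq : 0 < q) : 1 ≤ kernelConst q := by
  have : 0 < q ^ q := by positivity
  rw [kernelConst]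
  linarith

theorem gelfandNumber_lpId_le_min (p₁ p₂ : ℝ≥0∞) [Fact (1 ≤ p₁)] [Fact (1 ≤ p₂)] (h₁ : p₁ ≤ 2)
    (h₂ : 2 ≤ p₂) {q : ℝ} (hq : p₁.toReal.HolderConjugate q) {k : ℕ} (hk : 1 ≤ k) (hN : 0 < N) :
    gelfandNumber (lpId p₁ p₂ N) k ≤
      4 * kernelConst q * min 1 ((N : ℝ) ^ (1 / q) * (k : ℝ) ^ (-(1 / 2) : ℝ)) := by
  have h₁' : p₁ ≠ ∞ := ne_top_of_le_ne_top ENNReal.ofNat_ne_top h₁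
  have hone := gelfandNumber_le_one (N := N) p₁ p₂ h₁' (h₁.trans h₂) hk
  have hK := one_le_kernelConst hq.symm.pos
  have hNr : (1 : ℝ) ≤ N := by exact_mod_cast hN
  rw [mul_min_of_nonneg _ _ (by linarith), mul_one]
  refine le_min (by linarith) ?_
  rcases hk.eq_or_lt with rfl | hk1
  · have h1 : 1 ≤ (N : ℝ) ^ (1 / q) :=
      Real.one_le_rpow hNr (one_div_nonneg.mpr hq.symm.nonneg)
    simp only [Nat.cast_one, Real.one_rpow, mul_one]
    nlinarith
  · obtain ⟨m, rfl⟩ : ∃ m, k = m + 1 := ⟨k - 1, by lia⟩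
    have hm : 0 < m := by lia
    have hmr : (1 : ℝ) ≤ m := by exact_mod_cast hm
    refine (gelfandNumber_succ_le p₁ p₂ h₂ hq hm hN).trans ?_
    have h3 : 1 / √(m : ℝ) ≤ 2 * ((m + 1 : ℕ) : ℝ) ^ (-(1 / 2) : ℝ) := by
      rw [Real.rpow_neg (by positivity), ← Real.sqrt_eq_rpow, ← div_eq_mul_inv,
        div_le_div_iff₀ (by positivity) (by positivity), one_mul]
      refine Real.sqrt_le_iff.mpr ⟨by positivity, ?_⟩
      rw [mul_pow, Real.sq_sqrt (by positivity)]
      push_cast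
      linarith
    calc 2 * (kernelConst q * ((N : ℝ) ^ (1 / q) / √m))
        = 2 * kernelConst q * (N : ℝ) ^ (1 / q) * (1 / √m) := by ring
      _ ≤ 2 * kernelConst q * (N : ℝ) ^ (1 / q) *
          (2 * ((m + 1 : ℕ) : ℝ) ^ (-(1 / 2) : ℝ)) :=
        mul_le_mul_of_nonneg_left h3 (by positivity)
      _ = _ := by ring

end UpperBound

theorem toReal_inv_conjExp {p : ℝ≥0∞} (hp : 1 ≤ p) :
    (conjExp p)⁻¹.toReal = 1 - 1 / p.toReal := by
  rw [conjExp, inv_inv, ENNReal.toReal_sub_of_le (ENNReal.inv_le_one.mpr hp) ENNReal.one_ne_top,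
    ENNReal.toReal_one, ENNReal.toReal_inv, one_div]

/-- If `1 < p₁ < 2 < p₂ ≤ ∞`, then
`c_k(id : ℓ_{p₁}^N → ℓ_{p₂}^N) ∼ min(1, N^{1/p₁′} k^{-1/2})` for `4k ≤ N`. -/
theorem stmt12 (p₁ p₂ : ℝ≥0∞) [Fact (1 ≤ p₁)] [Fact (1 ≤ p₂)]
    (h₀ : 1 < p₁) (h₁ : p₁ < 2) (h₂ : 2 < p₂) :
    ∃ c₁ c₂ : ℝ, 0 < c₁ ∧ c₁ ≤ c₂ ∧
      ∀ N k : ℕ, 1 ≤ k → 4 * k ≤ N →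
        c₁ * min 1 ((N : ℝ) ^ (((conjExp p₁)⁻¹).toReal) * (k : ℝ) ^ (-(1/2) : ℝ))
            ≤ gelfandNumber (lpId p₁ p₂ N) k ∧
        gelfandNumber (lpId p₁ p₂ N) k
            ≤ c₂ * min 1 ((N : ℝ) ^ (((conjExp p₁)⁻¹).toReal) * (k : ℝ) ^ (-(1/2) : ℝ)) := by
  have hp1 : 1 < p₁.toReal := by
    simpa using ENNReal.toReal_strict_mono (ne_top_of_lt h₁) h₀
  have hq : p₁.toReal.HolderConjugate p₁.toReal.conjExponent := .conjExponent hp1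
  have hexp : (conjExp p₁)⁻¹.toReal = 1 / p₁.toReal.conjExponent := by
    rw [toReal_inv_conjExp h₀.le, one_div, one_div, ← hq.inv_add_inv_eq_one, add_sub_cancel_left]
  have hK := one_le_kernelConst hq.symm.pos
  refine ⟨3 / 8, 4 * kernelConst p₁.toReal.conjExponent, by norm_num, by linarith,
    fun N k hk hN => ⟨?_, ?_⟩⟩
  · rw [toReal_inv_conjExp h₀.le]
    exact min_le_gelfandNumber_lpId p₁ p₂ h₁.le hk hN
  · rw [hexp]
    exact gelfandNumber_lpId_le_min p₁ p₂ h₁.le h₂.le hq hk (by lia)
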